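/- Let λ ⊑ μ be partitions with |μ| = |λ| + 1 (i.e., a covering pair in the double domination order). Then there exist permutations σ and π with sh(σ) = λ, sh(π) = μ, and σ involved in π (σ ≼ π). -/

import Mathlib

/-- A partition: a weakly decreasing sequence of natural numbers (indexed from 0,
with missing parts treated as 0), having only finitely many nonzero parts. -/
structure YPartition where
  parts : ℕ → ℕ
  antitone : ∀ i j : ℕ, i ≤ j → parts j ≤ parts i
  finite : ∃ N : ℕ, ∀ i : ℕ, N ≤ i → parts i = 0

/-- Partial sum of the first `r` values of `f` (so `psum lam.parts r = λ_1 + ⋯ + λ_r`). -/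
def psum (f : ℕ → ℕ) (r : ℕ) : ℕ := ∑ i ∈ Finset.range r, f i

/-- The parts of the conjugate partition: `λ*_{i+1} = |{j : λ_j ≥ i+1}|` (0-indexed). -/
noncomputable def conjParts (p : YPartition) : ℕ → ℕ :=
  fun i => {j : ℕ | i + 1 ≤ p.parts j}.ncard

/-- The size `|λ| = Σ_i λ_i` of a partition. -/
noncomputable def size (p : YPartition) : ℕ := sSup (Set.range (psum p.parts))

/-- `μ` doubly dominates `lam`: each partial sum of parts of `μ` is at least the
corresponding one for `lam`, and the same for the conjugates. -/
def DoublyDominates (μ lam : YPartition) : Prop :=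
  (∀ r : ℕ, psum lam.parts r ≤ psum μ.parts r) ∧
  (∀ r : ℕ, psum (conjParts lam) r ≤ psum (conjParts μ) r)

/-- The positions in `S` form a union of `k` increasing subsequences of `π`. -/
def IsUnionKIncreasing {n : ℕ} (π : Equiv.Perm (Fin n)) (k : ℕ) (S : Finset (Fin n)) : Prop :=
  ∃ c : Fin n → Fin k, ∀ i ∈ S, ∀ j ∈ S, i < j → c i = c j → π i < π j

/-- The positions in `S` form a union of `k` decreasing subsequences of `π`. -/
def IsUnionKDecreasing {n : ℕ} (π : Equiv.Perm (Fin n)) (k : ℕ) (S : Finset (Fin n)) : Prop :=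
  ∃ c : Fin n → Fin k, ∀ i ∈ S, ∀ j ∈ S, i < j → c i = c j → π j < π i

/-- `I_k(π)`: the maximum size of a set of positions of `π` that is a union of `k`
increasing subsequences. -/
noncomputable def incMax {n : ℕ} (π : Equiv.Perm (Fin n)) (k : ℕ) : ℕ :=
  sSup {m : ℕ | ∃ S : Finset (Fin n), IsUnionKIncreasing π k S ∧ S.card = m}

/-- `D_k(π)`: the maximum size of a set of positions of `π` that is a union of `k`
decreasing subsequences. -/
noncomputable def decMax {n : ℕ} (π : Equiv.Perm (Fin n)) (k : ℕ) : ℕ :=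
  sSup {m : ℕ | ∃ S : Finset (Fin n), IsUnionKDecreasing π k S ∧ S.card = m}

/-- `σ` is involved in `π` (`σ ≼ π`): some subsequence of the values of `π` is in the
same relative order as the values of `σ`. -/
def Involved {m n : ℕ} (σ : Equiv.Perm (Fin m)) (π : Equiv.Perm (Fin n)) : Prop :=
  ∃ f : Fin m → Fin n, StrictMono f ∧ ∀ i j : Fin m, σ i < σ j ↔ π (f i) < π (f j)

/-- `π` has RSK shape `lam`, characterized via Greene's theorem:
`λ_1 + ⋯ + λ_k = I_k(π)` and `λ*_1 + ⋯ + λ*_k = D_k(π)` for all `k`. -/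
def HasShape {n : ℕ} (π : Equiv.Perm (Fin n)) (lam : YPartition) : Prop :=
  ∀ k : ℕ, psum lam.parts k = incMax π k ∧ psum (conjParts lam) k = decMax π k

/-- Rank equivalence: a finite set with an injective key into a linear order can be listed in
increasing order of the key. -/
theorem exists_equiv_fin_lt_iff {α L : Type*} [LinearOrder L] (S : Finset α) (f : α → L)
    (hf : Set.InjOn f S) :
    ∃ e : Fin S.card ≃ S, ∀ a b, a < b ↔ f (e a) < f (e b) := by
  let _ : LinearOrder S :=
    LinearOrder.lift' (fun x : S => f x) (fun x y h => Subtype.ext (hf x.2 y.2 h))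
  let e : S ≃o Fin S.card := (Fintype.orderIsoFinOfCardEq S (by simp)).symm
  refine ⟨e.symm.toEquiv, fun a b => ?_⟩
  exact (e.symm.lt_iff_lt (x := a) (y := b)).symm

/-- A finite set of points with injective position and value keys gives a permutation. -/
theorem exists_perm_of_keys {α L : Type*} [LinearOrder L] (S : Finset α) (pos val : α → L)
    (hp : Set.InjOn pos S) (hv : Set.InjOn val S) :
    ∃ (π : Equiv.Perm (Fin S.card)) (e : Fin S.card ≃ S),
      (∀ a b, a < b ↔ pos (e a) < pos (e b)) ∧ ∀ a b, π a < π b ↔ val (e a) < val (e b) := by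
  obtain ⟨e, he⟩ := exists_equiv_fin_lt_iff S pos hp
  obtain ⟨g, hg⟩ := exists_equiv_fin_lt_iff S val hv
  refine ⟨e.trans g.symm, e, he, fun a b => ?_⟩
  rw [hg]
  simp

/-- Greene-type duality: if every `r`-class is a `P`-chain, every `c`-class is a `P`-antichain and
the cells `(r a, c a)` are closed under decreasing `r` along each `c`-class, then the largest union
of `k` `P`-chains consists of the points with `r a < k`. -/
theorem sSup_card_union_chains {n : ℕ} (P : Fin n → Fin n → Prop) (r c : Fin n → ℕ)
    (hr : ∀ i j, i < j → r i = r j → P i j) (hc : ∀ i j, i < j → c i = c j → ¬ P i j)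
    (hdown : ∀ a, ∀ i ≤ r a, ∃ b, c b = c a ∧ r b = i) (k : ℕ) :
    sSup {m : ℕ | ∃ S : Finset (Fin n), (∃ d : Fin n → Fin k,
      ∀ i ∈ S, ∀ j ∈ S, i < j → d i = d j → P i j) ∧ S.card = m} =
      (Finset.univ.filter fun a => r a < k).card := by
  have hub : ∀ m ∈ {m : ℕ | ∃ S : Finset (Fin n), (∃ d : Fin n → Fin k,
      ∀ i ∈ S, ∀ j ∈ S, i < j → d i = d j → P i j) ∧ S.card = m},
      m ≤ (Finset.univ.filter fun a => r a < k).card := by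
    rintro m ⟨S, ⟨d, hd⟩, rfl⟩
    rw [Finset.card_eq_sum_card_fiberwise (s := S) (f := c) (t := Finset.univ.image c)
      (fun x _ => by simp),
      Finset.card_eq_sum_card_fiberwise (f := c) (t := Finset.univ.image c)
      (fun x _ => by simp)]
    refine Finset.sum_le_sum fun j _ => ?_
    by_cases hj : ∃ a, c a = j ∧ k ≤ r a
    · obtain ⟨a, rfl, hka⟩ := hj
      have h1 : (S.filter fun b => c b = c a).card ≤ k := by
        have := Finset.card_le_card_of_injOn (s := S.filter fun b => c b = c a)
          (t := (Finset.univ : Finset (Fin k))) d (fun _ _ => by simp) (by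
            intro x hx y hy hxy
            simp only [Finset.coe_filter, Set.mem_ofPred_eq] at hx hy
            rcases lt_trichotomy x y with h | h | h
            · exact absurd (hd x hx.1 y hy.1 h hxy) (hc x y h (hx.2.trans hy.2.symm))
            · exact h
            · exact absurd (hd y hy.1 x hx.1 h hxy.symm) (hc y x h (hy.2.trans hx.2.symm)))
        simpa using this
      refine h1.trans ?_
      have h2 := Finset.card_le_card_of_surjOn
        (s := (Finset.univ.filter fun b => r b < k).filter fun b => c b = c a)
        (t := Finset.range k) r (by
          intro i hi
          have hi : i < k := by simpa using hi
          obtain ⟨b, hb, rfl⟩ := hdown a i (by omega)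
          exact ⟨b, by simp [hb, hi], rfl⟩)
      simpa using h2
    · push Not at hj
      refine Finset.card_le_card fun x hx => ?_
      simp only [Finset.mem_filter, Finset.mem_univ, true_and] at hx ⊢
      exact ⟨hj x hx.2, hx.2⟩
  rcases Nat.eq_zero_or_pos k with rfl | hk
  · refine le_antisymm (csSup_le' hub) (by simp)
  · refine le_antisymm (csSup_le' hub) (le_csSup ⟨_, hub⟩
      ⟨_, ⟨fun a => ⟨r a % k, Nat.mod_lt _ hk⟩, ?_⟩, rfl⟩)
    intro i hi j hj hij h
    simp only [Finset.mem_filter, Finset.mem_univ, true_and] at hi hj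
    simp only [Fin.mk.injEq, Nat.mod_eq_of_lt hi, Nat.mod_eq_of_lt hj] at h
    exact hr i j hij h

theorem psum_eq_of_le {f : ℕ → ℕ} {N : ℕ} (hN : ∀ i, N ≤ i → f i = 0) {M : ℕ} (hM : N ≤ M) :
    psum f M = psum f N := by
  unfold psum
  symm
  refine Finset.sum_subset (Finset.range_subset_range.2 hM) fun i _ hi => hN i ?_
  simpa using hi

theorem psum_mono (f : ℕ → ℕ) {a b : ℕ} (h : a ≤ b) : psum f a ≤ psum f b :=
  Finset.sum_le_sum_of_subset (Finset.range_subset_range.2 h)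

theorem size_eq_psum (p : YPartition) {N : ℕ} (hN : ∀ i, N ≤ i → p.parts i = 0) :
    size p = psum p.parts N := by
  have hub : ∀ x ∈ Set.range (psum p.parts), x ≤ psum p.parts N := by
    rintro _ ⟨r, rfl⟩
    rcases le_total r N with h | h
    · exact psum_mono _ h
    · exact (psum_eq_of_le hN h).le
  exact le_antisymm (csSup_le' hub) (le_csSup ⟨_, hub⟩ ⟨N, rfl⟩)

/-- The first `N` rows of the Young diagram of the sequence `f`. -/
def cells (f : ℕ → ℕ) (N : ℕ) : Finset (ℕ × ℕ) :=
  (Finset.range N).biUnion fun i => (Finset.range (f i)).image fun j => (i, j)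

theorem mem_cells {f : ℕ → ℕ} {N : ℕ} {x : ℕ × ℕ} :
    x ∈ cells f N ↔ x.1 < N ∧ x.2 < f x.1 := by
  obtain ⟨i, j⟩ := x
  simp only [cells, Finset.mem_biUnion, Finset.mem_range, Finset.mem_image, Prod.mk.injEq]
  constructor
  · rintro ⟨a, ha, b, hb, rfl, rfl⟩
    exact ⟨ha, hb⟩
  · rintro ⟨ha, hb⟩
    exact ⟨i, ha, j, hb, rfl, rfl⟩

theorem card_cells (f : ℕ → ℕ) (N : ℕ) : (cells f N).card = psum f N := by
  unfold cells psum
  rw [Finset.card_biUnion]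
  · refine Finset.sum_congr rfl fun i _ => ?_
    rw [Finset.card_image_of_injective _ (fun a b h => by simpa using h), Finset.card_range]
  · intro a _ b _ hab
    simp only [Finset.disjoint_left, Finset.mem_image, Finset.mem_range]
    rintro x ⟨_, _, rfl⟩ ⟨_, _, h⟩
    exact hab (congrArg Prod.fst h).symm

theorem psum_conjParts (p : YPartition) {N : ℕ} (hN : ∀ i, N ≤ i → p.parts i = 0) (k : ℕ) :
    psum (conjParts p) k = ((cells p.parts N).filter fun x => x.2 < k).card := by
  rw [Finset.card_eq_sum_card_fiberwise (f := Prod.snd) (t := Finset.range k)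
    (fun x hx => by simpa using (Finset.mem_filter.1 hx).2)]
  unfold psum
  refine Finset.sum_congr rfl fun j hj => ?_
  have hj : j < k := by simpa using hj
  rw [conjParts, ← Set.ncard_coe_finset]
  refine (Set.ncard_congr (fun x _ => x.1) ?_ ?_ ?_).symm
  · intro x hx
    simp only [Finset.coe_filter, Finset.mem_filter, mem_cells, Set.mem_ofPred_eq] at hx ⊢
    omega
  · intro x y hx hy h
    simp only [Finset.coe_filter, Finset.mem_filter, mem_cells, Set.mem_ofPred_eq] at hx hy
    exact Prod.ext h (hx.2.trans hy.2.symm)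
  · intro i hi
    simp only [Set.mem_ofPred_eq] at hi
    refine ⟨(i, j), ?_, rfl⟩
    simp only [Finset.coe_filter, Finset.mem_filter, mem_cells, Set.mem_ofPred_eq]
    refine ⟨⟨⟨?_, by omega⟩, hj⟩, trivial⟩
    by_contra h
    have := hN i (by omega)
    omega

theorem psum_conjParts_eq_sum_min (p : YPartition) {N : ℕ} (hN : ∀ i, N ≤ i → p.parts i = 0)
    (k : ℕ) : psum (conjParts p) k = psum (fun i => min (p.parts i) k) N := by
  rw [psum_conjParts p hN, ← card_cells]
  congr 1
  ext x
  simp only [Finset.mem_filter, mem_cells]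
  omega

theorem psum_eq_card_filter (p : YPartition) {N : ℕ} (hN : ∀ i, N ≤ i → p.parts i = 0) (k : ℕ) :
    psum p.parts k = ((cells p.parts N).filter fun x => x.1 < k).card := by
  rw [← card_cells]
  congr 1
  ext x
  simp only [Finset.mem_filter, mem_cells]
  constructor
  · rintro ⟨h1, h2⟩
    refine ⟨⟨?_, h2⟩, h1⟩
    by_contra h
    have := hN x.1 (by omega)
    omega
  · rintro ⟨⟨_, h2⟩, h1⟩
    exact ⟨h1, h2⟩

/-- If the points of a permutation can be placed bijectively on the cells of a Young diagram so
that rows are increasing and columns are decreasing subsequences, then the permutation has the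
shape of that diagram. -/
theorem hasShape_of_placement {n : ℕ} (π : Equiv.Perm (Fin n)) (p : YPartition)
    (hn : size p = n) (r c : Fin n → ℕ)
    (hr : ∀ i j, i < j → r i = r j → π i < π j) (hc : ∀ i j, i < j → c i = c j → π j < π i)
    (hcell : ∀ a, c a < p.parts (r a)) : HasShape π p := by
  obtain ⟨N, hN⟩ := p.finite
  have hinj : Function.Injective fun a => (r a, c a) := by
    intro a b h
    simp only [Prod.mk.injEq] at h
    rcases lt_trichotomy a b with hab | hab | hab
    · exact absurd (hr a b hab h.1) (hc a b hab h.2).asymm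
    · exact hab
    · exact absurd (hr b a hab h.1.symm) (hc b a hab h.2.symm).asymm
  have himg : Finset.univ.image (fun a => (r a, c a)) = cells p.parts N := by
    apply Finset.eq_of_subset_of_card_le
    · intro x hx
      obtain ⟨a, -, rfl⟩ := Finset.mem_image.1 hx
      have ha := hcell a
      refine mem_cells.2 ⟨?_, ha⟩
      by_contra h
      have := hN (r a) (by simpa using h)
      omega
    · rw [Finset.card_image_of_injective _ hinj, card_cells, ← size_eq_psum p hN, hn]
      simp
  have hsurj : ∀ i j, j < p.parts i → ∃ a, r a = i ∧ c a = j := by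
    intro i j hij
    have hmem : (i, j) ∈ cells p.parts N := by
      refine mem_cells.2 ⟨?_, hij⟩
      by_contra h
      have := hN i (by simpa using h)
      omega
    rw [← himg] at hmem
    obtain ⟨a, -, ha⟩ := Finset.mem_image.1 hmem
    exact ⟨a, by simpa using ha⟩
  have hcard : ∀ q : ℕ × ℕ → Prop, ∀ [DecidablePred q],
      ((cells p.parts N).filter q).card = (Finset.univ.filter fun a => q (r a, c a)).card := by
    intro q _
    rw [← himg, Finset.filter_image, Finset.card_image_of_injective _ hinj]
  intro k
  constructor
  · rw [psum_eq_card_filter p hN, hcard fun x => x.1 < k]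
    refine (sSup_card_union_chains (fun i j => π i < π j) r c hr
      (fun i j hij h => (hc i j hij h).not_gt) ?_ k).symm
    intro a i hi
    obtain ⟨b, h1, h2⟩ := hsurj i (c a) ((hcell a).trans_le (p.antitone _ _ hi))
    exact ⟨b, h2, h1⟩
  · rw [psum_conjParts p hN, hcard fun x => x.2 < k]
    refine (sSup_card_union_chains (fun i j => π j < π i) c r hc
      (fun i j hij h => (hr i j hij h).not_gt) ?_ k).symm
    intro a j hj
    exact hsurj (r a) j (hj.trans_lt (hcell a))

/-- Double domination with one extra cell forces the partial sums to differ by at most one. -/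
theorem psum_le_psum_add_one {lam μ : YPartition} (hdom : DoublyDominates μ lam)
    (hsize : size μ = size lam + 1) (r : ℕ) : psum μ.parts r ≤ psum lam.parts r + 1 := by
  obtain ⟨N₁, h₁⟩ := lam.finite
  obtain ⟨N₂, h₂⟩ := μ.finite
  obtain ⟨s, h₁, h₂⟩ : ∃ s, (∀ i, r + s ≤ i → lam.parts i = 0) ∧
      (∀ i, r + s ≤ i → μ.parts i = 0) :=
    ⟨N₁ + N₂, fun i hi => h₁ i (by omega), fun i hi => h₂ i (by omega)⟩
  rw [size_eq_psum _ h₁, size_eq_psum _ h₂] at hsize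
  have hconj := hdom.2 (lam.parts r)
  rw [psum_conjParts_eq_sum_min _ h₁, psum_conjParts_eq_sum_min _ h₂] at hconj
  unfold psum at *
  rw [Finset.sum_range_add, Finset.sum_range_add] at hconj hsize
  have e1 : ∑ x ∈ Finset.range r, min (lam.parts x) (lam.parts r) = r * lam.parts r := by
    rw [Finset.sum_congr rfl (g := fun _ => lam.parts r)]
    · simp
    · intro x hx
      exact min_eq_right (lam.antitone _ _ (by simp at hx; omega))
  have e2 : ∑ x ∈ Finset.range s, min (lam.parts (r + x)) (lam.parts r) =
      ∑ x ∈ Finset.range s, lam.parts (r + x) :=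
    Finset.sum_congr rfl fun x _ => min_eq_left (lam.antitone _ _ (by omega))
  have e3 : ∑ x ∈ Finset.range r, min (μ.parts x) (lam.parts r) ≤ r * lam.parts r := by
    refine (Finset.sum_le_sum (g := fun _ => lam.parts r) fun x _ => min_le_right _ _).trans ?_
    simp
  have e4 : ∑ x ∈ Finset.range s, min (μ.parts (r + x)) (lam.parts r) ≤
      ∑ x ∈ Finset.range s, μ.parts (r + x) :=
    Finset.sum_le_sum fun x _ => min_le_left _ _
  omega

/-- The rows in which two partitions differ form an alternating chain `ρ 0 < ⋯ < ρ (2 * t)`, and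
the cells in which they differ are `(ρ p, κ p)` with `κ` strictly decreasing. -/
theorem exists_alternating_chain {l m : ℕ → ℕ} (hl : ∀ i j, i ≤ j → l j ≤ l i)
    (hm : ∀ i j, i ≤ j → m j ≤ m i) {N : ℕ} (hlN : ∀ i, N ≤ i → l i = 0)
    (hmN : ∀ i, N ≤ i → m i = 0) (hle : ∀ r, psum l r ≤ psum m r)
    (hge : ∀ r, psum m r ≤ psum l r + 1) (htot : psum m N = psum l N + 1) :
    ∃ (t : ℕ) (ρ κ : ℕ → ℕ), (∀ p ≤ 2 * t, ∀ q ≤ 2 * t, p < q → κ q < κ p) ∧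
      (∀ p ≤ 2 * t, ∀ q ≤ 2 * t, ρ p = ρ q → p = q) ∧
      (∀ p ≤ 2 * t, p % 2 = 0 → l (ρ p) = κ p ∧ m (ρ p) = κ p + 1) ∧
      (∀ p ≤ 2 * t, p % 2 = 1 → l (ρ p) = κ p + 1 ∧ m (ρ p) = κ p) ∧
      (∀ i, (∀ p ≤ 2 * t, ρ p ≠ i) → l i = m i) := by
  classical
  obtain ⟨R, hR⟩ : ∃ R : ℕ → Prop, ∀ i, R i ↔ l i ≠ m i := ⟨_, fun _ => Iff.rfl⟩
  have hsucc : ∀ (f : ℕ → ℕ) r, psum f (r + 1) = psum f r + f r :=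
    fun f r => Finset.sum_range_succ f r
  have hcount : ∀ r, psum m r = psum l r + Nat.count R r % 2 := by
    intro r
    induction r with
    | zero => simp [psum]
    | succ r ih =>
      have h1 := hsucc l r
      have h2 := hsucc m r
      have h3 := hle (r + 1)
      have h4 := hge (r + 1)
      rw [Nat.count_succ]
      split_ifs with h <;> rw [hR] at h <;> omega
  obtain ⟨t, ht⟩ : ∃ t, Nat.count R N = 2 * t + 1 :=
    ⟨Nat.count R N / 2, by have := hcount N; omega⟩
  have hcard : ∀ p ≤ 2 * t, ∀ hf : (Set.ofPred R).Finite, p < hf.toFinset.card := by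
    intro p hp hf
    have := Nat.count_le_card hf N
    omega
  have hmem : ∀ p ≤ 2 * t, R (Nat.nth R p) := fun p hp => Nat.nth_mem p (hcard p hp)
  have hcn : ∀ p ≤ 2 * t, Nat.count R (Nat.nth R p) = p := fun p hp => Nat.count_nth (hcard p hp)
  have hinj : ∀ p ≤ 2 * t, ∀ q ≤ 2 * t, Nat.nth R p = Nat.nth R q → p = q := by
    intro p hp q hq h
    rw [← hcn p hp, h, hcn q hq]
  have hstep : ∀ p ≤ 2 * t, psum m (Nat.nth R p) = psum l (Nat.nth R p) + p % 2 ∧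
      psum m (Nat.nth R p + 1) = psum l (Nat.nth R p + 1) + (p + 1) % 2 := by
    intro p hp
    have h1 := hcount (Nat.nth R p)
    have h2 := hcount (Nat.nth R p + 1)
    rw [Nat.count_succ, if_pos (hmem p hp), hcn p hp] at h2
    rw [hcn p hp] at h1
    exact ⟨h1, h2⟩
  have heven : ∀ p ≤ 2 * t, p % 2 = 0 →
      l (Nat.nth R p) = min (l (Nat.nth R p)) (m (Nat.nth R p)) ∧
      m (Nat.nth R p) = min (l (Nat.nth R p)) (m (Nat.nth R p)) + 1 := by
    intro p hp h
    have h1 := hstep p hp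
    rw [hsucc, hsucc] at h1
    omega
  have hodd : ∀ p ≤ 2 * t, p % 2 = 1 →
      l (Nat.nth R p) = min (l (Nat.nth R p)) (m (Nat.nth R p)) + 1 ∧
      m (Nat.nth R p) = min (l (Nat.nth R p)) (m (Nat.nth R p)) := by
    intro p hp h
    have h1 := hstep p hp
    rw [hsucc, hsucc] at h1
    omega
  refine ⟨t, Nat.nth R, fun p => min (l (Nat.nth R p)) (m (Nat.nth R p)), ?_, hinj, heven, hodd, ?_⟩
  · have hnext : ∀ p, p + 1 ≤ 2 * t →
        min (l (Nat.nth R (p + 1))) (m (Nat.nth R (p + 1))) <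
          min (l (Nat.nth R p)) (m (Nat.nth R p)) := by
      intro p hp
      have hlt : Nat.nth R p < Nat.nth R (p + 1) :=
        Nat.nth_lt_of_lt_count (by rw [hcn (p + 1) hp]; omega)
      have h1 := hl _ _ hlt.le
      have h2 := hm _ _ hlt.le
      rcases Nat.mod_two_eq_zero_or_one p with h | h
      · have h3 := heven p (by omega) h
        have h4 := hodd (p + 1) hp (by omega)
        omega
      · have h3 := hodd p (by omega) h
        have h4 := heven (p + 1) hp (by omega)
        omega
    intro p hp q hq hpq
    induction q with
    | zero => omega
    | succ q ih =>
      rcases Nat.lt_or_ge p q with h | h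
      · exact (hnext q hq).trans (ih (by omega) h)
      · obtain rfl : p = q := by omega
        exact hnext p hq
  · intro i hi
    by_contra hne
    have hiN : i < N := by
      by_contra h
      exact hne ((hlN i (by omega)).trans (hmN i (by omega)).symm)
    have hlt := Nat.count_strict_mono ((hR i).2 hne) hiN
    exact hi (Nat.count R i) (by omega) (Nat.nth_count ((hR i).2 hne))

/-- An index of `i` in the injective list `ρ 0, …, ρ n`, or `-1` if there is none. -/
theorem exists_index (ρ : ℕ → ℕ) (n : ℕ) (hρ : ∀ p ≤ n, ∀ q ≤ n, ρ p = ρ q → p = q) :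
    ∃ f : ℕ → ℤ, (∀ p ≤ n, f (ρ p) = p) ∧
      ∀ i, (f i = -1 ∧ ∀ p ≤ n, ρ p ≠ i) ∨ ∃ p ≤ n, ρ p = i ∧ f i = p := by
  classical
  have key : ∀ i, ∃ z : ℤ, (z = -1 ∧ ∀ p ≤ n, ρ p ≠ i) ∨ ∃ p ≤ n, ρ p = i ∧ z = p := by
    intro i
    by_cases h : ∃ p ≤ n, ρ p = i
    · obtain ⟨p, hp, h⟩ := h
      exact ⟨p, Or.inr ⟨p, hp, h, rfl⟩⟩
    · push Not at h
      exact ⟨-1, Or.inl ⟨rfl, h⟩⟩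
  choose f hf using key
  refine ⟨f, fun p hp => ?_, hf⟩
  rcases hf (ρ p) with ⟨_, h⟩ | ⟨q, hq, h, h'⟩
  · exact absurd rfl (h p hp)
  · rw [h', hρ q hq p hp h]

/-- The list `0, 1, -1, 2, -2, …` of integers. -/
def zigzag (p : ℤ) : ℤ := if p % 2 = 0 then -(p / 2) else (p + 1) / 2

theorem zigzag_inj {p q : ℤ} (hp : 0 ≤ p) (hq : 0 ≤ q) (h : zigzag p = zigzag q) : p = q := by
  unfold zigzag at h
  split_ifs at h <;> omega

/-- The index of the increasing chain through `(x, y)` in the partition of a punctured diamond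
into chains which bend upwards or downwards around the centre. -/
def bentRow (x y : ℤ) : ℤ :=
  if 0 ≤ y ∧ x < 0 then 2 * y else if 0 < y ∧ 0 ≤ x then 2 * y - 2
  else if y < 0 ∧ x ≤ 0 then -2 * y - 1 else -2 * y + 1

theorem bentRow_increasing {x y x' y' : ℤ} (h₀ : x ≠ 0 ∨ y ≠ 0) (h₁ : x' ≠ 0 ∨ y' ≠ 0)
    (h : bentRow x y = bentRow x' y') (hlt : x < x' ∨ x = x' ∧ y' < y) : x < x' ∧ y ≤ y' := by
  unfold bentRow at h
  split_ifs at h <;> omega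

/-- The two indices of a point of the punctured diamond of radius `t` form a cell of the staircase
with doubled steps. -/
theorem bentRow_cell {x y t : ℤ} (h₀ : x ≠ 0 ∨ y ≠ 0) 
    (h : x + y ≤ t ∧ x - y ≤ t ∧ y - x ≤ t ∧ -x - y ≤ t) :
    0 ≤ bentRow x y ∧ 0 ≤ bentRow (-y) x ∧ (bentRow x y + bentRow (-y) x < 2 * t ∨
      bentRow x y + bentRow (-y) x = 2 * t ∧ bentRow x y % 2 = 1) := by
  unfold bentRow
  split_ifs <;> omega

theorem zigzag_cell {p q t x y : ℤ} (hp : 0 ≤ p) (hq : 0 ≤ q)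
    (h : p + q < 2 * t ∨ p + q = 2 * t ∧ p % 2 = 0) (hx : x = zigzag q) (hy : y = zigzag p) :
    x + y ≤ t ∧ x - y ≤ t ∧ y - x ≤ t ∧ -x - y ≤ t := by
  unfold zigzag at hx hy
  split_ifs at hx hy <;> omega

theorem zigzag_bounds {p t : ℤ} (hp : 0 ≤ p) (h : p ≤ 2 * t) : -t ≤ zigzag p ∧ zigzag p ≤ t := by
  unfold zigzag
  split_ifs <;> omega

set_option maxHeartbeats 400000 in
/-- Planar coordinates for the cells of the larger of two partitions which differ along an
alternating chain.  The cells of the smaller partition are placed on the same points except one. -/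
theorem exists_coordinates {l m : ℕ → ℕ} {t N : ℕ} {ρ κ : ℕ → ℕ}
    (hmN : ∀ i, m i ≤ N)
    (hκ : ∀ p ≤ 2 * t, ∀ q ≤ 2 * t, p < q → κ q < κ p)
    (hρ : ∀ p ≤ 2 * t, ∀ q ≤ 2 * t, ρ p = ρ q → p = q)
    (heven : ∀ p ≤ 2 * t, p % 2 = 0 → l (ρ p) = κ p ∧ m (ρ p) = κ p + 1)
    (hodd : ∀ p ≤ 2 * t, p % 2 = 1 → l (ρ p) = κ p + 1 ∧ m (ρ p) = κ p)
    (hoff : ∀ i, (∀ p ≤ 2 * t, ρ p ≠ i) → l i = m i) (hρN : ρ 0 < N) :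
    ∃ (X Y : ℕ × ℕ → ℤ) (r c : ℕ × ℕ → ℕ), ∃ o ∈ cells m N,
      (∀ x ∈ cells m N, ∀ y ∈ cells m N, X x = X y → Y x = Y y → x = y) ∧
      (∀ x ∈ cells m N, ∀ y ∈ cells m N, (X x < X y ∨ X x = X y ∧ Y y < Y x) → x.1 = y.1 →
        X x < X y ∧ Y x ≤ Y y) ∧
      (∀ x ∈ cells m N, ∀ y ∈ cells m N, (X x < X y ∨ X x = X y ∧ Y y < Y x) → x.2 = y.2 →
        X x ≤ X y ∧ Y y < Y x) ∧
      (∀ x ∈ (cells m N).erase o, ∀ y ∈ (cells m N).erase o,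
        (X x < X y ∨ X x = X y ∧ Y y < Y x) → r x = r y → X x < X y ∧ Y x ≤ Y y) ∧
      (∀ x ∈ (cells m N).erase o, ∀ y ∈ (cells m N).erase o,
        (X x < X y ∨ X x = X y ∧ Y y < Y x) → c x = c y → X x ≤ X y ∧ Y y < Y x) ∧
      ∀ x ∈ (cells m N).erase o, c x < l (r x) := by
  have hκinj : ∀ p ≤ 2 * t, ∀ q ≤ 2 * t, κ p = κ q → p = q := by
    intro p hp q hq h
    rcases lt_trichotomy p q with h' | h' | h'
    · have := hκ p hp q hq h'
      omega
    · exact h'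
    · have := hκ q hq p hp h'
      omega
  have hmcell : ∀ p ≤ 2 * t, ∀ q ≤ 2 * t, κ q < m (ρ p) → p < q ∨ p = q ∧ p % 2 = 0 := by
    intro p hp q hq h
    have h1 := heven p hp
    have h2 := hodd p hp
    rcases lt_trichotomy p q with h' | rfl | h'
    · exact Or.inl h'
    · omega
    · have := hκ q hq p hp h'
      omega
  have hlcell : ∀ p ≤ 2 * t, ∀ q ≤ 2 * t, (p < q ∨ p = q ∧ p % 2 = 1) → κ q < l (ρ p) := by
    intro p hp q hq h
    have h1 := heven p hp
    have h2 := hodd p hp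
    rcases h with h' | ⟨rfl, h'⟩
    · have := hκ p hp q hq h'
      omega
    · omega
  obtain ⟨u, hu, hu'⟩ := exists_index ρ (2 * t) hρ
  obtain ⟨v, hv, hv'⟩ := exists_index κ (2 * t) hκinj
  have hubd : ∀ i, u i = -1 ∨ 0 ≤ u i ∧ u i ≤ 2 * t := by
    intro i
    rcases hu' i with h | ⟨p, hp, -, h⟩ <;> omega
  have hvbd : ∀ j, v j = -1 ∨ 0 ≤ v j ∧ v j ≤ 2 * t := by
    intro j
    rcases hv' j with h | ⟨p, hp, -, h⟩ <;> omega
  have huinj : ∀ i i', 0 ≤ u i → u i = u i' → i = i' := by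
    intro i i' h0 h
    rcases hu' i with h1 | ⟨p, hp, rfl, h1⟩
    · omega
    rcases hu' i' with h2 | ⟨p', hp', rfl, h2⟩
    · omega
    rw [show p = p' by omega]
  have hvinj : ∀ j j', 0 ≤ v j → v j = v j' → j = j' := by
    intro j j' h0 h
    rcases hv' j with h1 | ⟨p, hp, rfl, h1⟩
    · omega
    rcases hv' j' with h2 | ⟨p', hp', rfl, h2⟩
    · omega
    rw [show p = p' by omega]
  obtain ⟨a, ha⟩ : ∃ a : ℕ → ℤ, ∀ j, a j = zigzag (2 * t - v j) := ⟨_, fun _ => rfl⟩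
  obtain ⟨b, hb⟩ : ∃ b : ℕ → ℤ, ∀ i, b i = zigzag (u i) := ⟨_, fun _ => rfl⟩
  have habd : ∀ j, 0 ≤ v j → -(t : ℤ) ≤ a j ∧ a j ≤ t := by
    intro j h
    rw [ha]
    exact zigzag_bounds (by have := hvbd j; omega) (by omega)
  have hbbd : ∀ i, 0 ≤ u i → -(t : ℤ) ≤ b i ∧ b i ≤ t := by
    intro i h
    rw [hb]
    exact zigzag_bounds h (by have := hubd i; omega)
  have hainj : ∀ j j', 0 ≤ v j → 0 ≤ v j' → a j = a j' → j = j' := by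
    intro j j' h h' e
    rw [ha, ha] at e
    have h1 := hvbd j
    have h2 := hvbd j'
    have := zigzag_inj (by omega) (by omega) e
    exact hvinj _ _ h (by omega)
  have hbinj : ∀ i i', 0 ≤ u i → 0 ≤ u i' → b i = b i' → i = i' := by
    intro i i' h h' e
    rw [hb, hb] at e
    exact huinj _ _ h (zigzag_inj h h' e)
  obtain ⟨X, hX⟩ : ∃ X : ℕ × ℕ → ℤ, ∀ x, X x = if v x.2 < 0 then (t : ℤ) + 1 + N + x.2 else
      if u x.1 < 0 then (t : ℤ) + 1 + x.2 else a x.2 := ⟨_, fun _ => rfl⟩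
  obtain ⟨Y, hY⟩ : ∃ Y : ℕ × ℕ → ℤ, ∀ x, Y x = if v x.2 < 0 then (t : ℤ) + 1 + N - x.1 else
      if u x.1 < 0 then -((t : ℤ) + 1) - x.1 else b x.1 := ⟨_, fun _ => rfl⟩
  -- the three regions of the picture
  have hreg : ∀ x ∈ cells m N,
      (v x.2 < 0 ∧ X x = t + 1 + N + x.2 ∧ Y x = t + 1 + N - x.1 ∧ x.1 < N ∧ x.2 < N) ∨
      (0 ≤ v x.2 ∧ u x.1 < 0 ∧ X x = t + 1 + x.2 ∧ Y x = -(t + 1) - x.1 ∧ x.1 < N ∧ x.2 < N) ∨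
      (0 ≤ v x.2 ∧ 0 ≤ u x.1 ∧ X x = a x.2 ∧ Y x = b x.1 ∧ -t ≤ X x ∧ X x ≤ t ∧ -t ≤ Y x ∧
        Y x ≤ t) := by
    intro x hx
    rw [mem_cells] at hx
    have h1 := hmN x.1
    have h2 := habd x.2
    have h3 := hbbd x.1
    rw [hX, hY]
    split_ifs <;> omega
  have hcore : ∀ x ∈ cells m N, 0 ≤ v x.2 → 0 ≤ u x.1 →
      X x + Y x ≤ t ∧ X x - Y x ≤ t ∧ Y x - X x ≤ t ∧ -X x - Y x ≤ t := by
    intro x hx h1 h2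
    have hx' := hreg x hx
    rw [mem_cells] at hx
    rcases hu' x.1 with h3 | ⟨p, hp, hpx, h3⟩
    · omega
    rcases hv' x.2 with h4 | ⟨q, hq, hqx, h4⟩
    · omega
    have h5 := hmcell p hp q hq (by rw [hpx, hqx]; exact hx.2)
    refine zigzag_cell (p := u x.1) (q := 2 * t - v x.2) h2 (by omega) (by omega) ?_ ?_
    · rw [← ha]
      omega
    · rw [← hb]
      omega
  have hmo : (ρ 0, κ (2 * t)) ∈ cells m N := by
    refine mem_cells.2 ⟨hρN, ?_⟩
    have h1 := (heven 0 (by omega) rfl).2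
    rcases Nat.eq_zero_or_pos t with rfl | h
    · simp [h1]
    · have := hκ 0 (by omega) (2 * t) le_rfl (by omega)
      simp only
      omega
  have hne : ∀ x ∈ (cells m N).erase (ρ 0, κ (2 * t)), 0 ≤ v x.2 → 0 ≤ u x.1 →
      X x ≠ 0 ∨ Y x ≠ 0 := by
    intro x hx h1 h2
    rw [Finset.mem_erase] at hx
    by_contra! h
    have hx' := hreg x hx.2
    have e0 : zigzag 0 = 0 := by simp [zigzag]
    have e1 := hu 0 (by omega)
    have e2 := hv (2 * t) le_rfl
    refine hx.1 (Prod.ext (hbinj _ _ h2 (by simp [e1]) ?_) (hainj _ _ h1 (by simp only; omega) ?_))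
    · simp only [hb (ρ 0), e1, Nat.cast_zero, e0]
      omega
    · simp only [ha (κ (2 * t)), e2]
      rw [show 2 * (t : ℤ) - (2 * t : ℕ) = 0 by push_cast; ring, e0]
      omega
  obtain ⟨r, hr⟩ : ∃ r : ℕ × ℕ → ℕ, ∀ x, r x = if 0 ≤ v x.2 ∧ 0 ≤ u x.1 then
      ρ (bentRow (X x) (Y x)).toNat else x.1 := ⟨_, fun _ => rfl⟩
  obtain ⟨c, hc⟩ : ∃ c : ℕ × ℕ → ℕ, ∀ x, c x = if 0 ≤ v x.2 ∧ 0 ≤ u x.1 then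
      κ (2 * t - bentRow (-Y x) (X x)).toNat else x.2 := ⟨_, fun _ => rfl⟩
  have hrc : ∀ x ∈ (cells m N).erase (ρ 0, κ (2 * t)), 0 ≤ v x.2 → 0 ≤ u x.1 →
      ∃ p ≤ 2 * t, ∃ q ≤ 2 * t, bentRow (X x) (Y x) = p ∧ bentRow (-Y x) (X x) = 2 * t - q ∧
        r x = ρ p ∧ c x = κ q ∧ (p < q ∨ p = q ∧ p % 2 = 1) := by
    intro x hx h1 h2
    have h3 := bentRow_cell (hne x hx h1 h2) (hcore x (Finset.mem_of_mem_erase hx) h1 h2)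
    refine ⟨(bentRow (X x) (Y x)).toNat, by omega, (2 * t - bentRow (-Y x) (X x)).toNat, by omega,
      by omega, by omega, ?_, ?_, by omega⟩
    · rw [hr, if_pos ⟨h1, h2⟩]
    · rw [hc, if_pos ⟨h1, h2⟩]
  refine ⟨X, Y, r, c, _, hmo, ?_, ?_, ?_, ?_, ?_, ?_⟩
  · intro x hx y hy h1 h2
    have h3 := hainj x.2 y.2
    have h4 := hbinj x.1 y.1
    rcases hreg x hx with hx' | hx' | hx' <;> rcases hreg y hy with hy' | hy' | hy'
    case inr.inr.inr.inr =>
      exact Prod.ext (h4 hx'.2.1 hy'.2.1 (by omega)) (h3 hx'.1 hy'.1 (by omega))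
    all_goals
      clear h3 h4
      apply Prod.ext <;> omega
  · intro x hx y hy hlt h
    have hx' := hreg x hx
    rw [h] at hx'
    rcases hx' with hx' | hx' | hx' <;> rcases hreg y hy with hy' | hy' | hy' <;> omega
  · intro x hx y hy hlt h
    have hx' := hreg x hx
    rw [h] at hx'
    rcases hx' with hx' | hx' | hx' <;> rcases hreg y hy with hy' | hy' | hy' <;> omega
  · intro x hx y hy hlt h
    have hx' := hreg x (Finset.mem_of_mem_erase hx)
    have hy' := hreg y (Finset.mem_of_mem_erase hy)
    by_cases h1 : 0 ≤ v x.2 ∧ 0 ≤ u x.1 <;> by_cases h2 : 0 ≤ v y.2 ∧ 0 ≤ u y.1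
    · obtain ⟨p, hp, q, hq, e1, e2, e3, e4, -⟩ := hrc x hx h1.1 h1.2
      obtain ⟨p', hp', q', hq', e1', e2', e3', e4', -⟩ := hrc y hy h2.1 h2.2
      have := hρ p hp p' hp' (by rw [← e3, ← e3', h])
      exact bentRow_increasing (hne x hx h1.1 h1.2) (hne y hy h2.1 h2.2)
        (by rw [e1, e1', this]) hlt
    · obtain ⟨p, hp, q, hq, e1, e2, e3, e4, -⟩ := hrc x hx h1.1 h1.2
      rw [hr y, if_neg h2, e3] at h
      have := hu p hp
      rw [h] at this
      rcases hx' with hx' | hx' | hx' <;> rcases hy' with hy' | hy' | hy' <;> omega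
    · obtain ⟨p, hp, q, hq, e1, e2, e3, e4, -⟩ := hrc y hy h2.1 h2.2
      rw [hr x, if_neg h1, e3] at h
      have := hu p hp
      rw [← h] at this
      rcases hx' with hx' | hx' | hx' <;> rcases hy' with hy' | hy' | hy' <;> omega
    · rw [hr x, if_neg h1, hr y, if_neg h2] at h
      rw [h] at hx'
      rcases hx' with hx' | hx' | hx' <;> rcases hy' with hy' | hy' | hy' <;> omega
  · intro x hx y hy hlt h
    have hx' := hreg x (Finset.mem_of_mem_erase hx)
    have hy' := hreg y (Finset.mem_of_mem_erase hy)
    by_cases h1 : 0 ≤ v x.2 ∧ 0 ≤ u x.1 <;> by_cases h2 : 0 ≤ v y.2 ∧ 0 ≤ u y.1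
    · obtain ⟨p, hp, q, hq, e1, e2, e3, e4, -⟩ := hrc x hx h1.1 h1.2
      obtain ⟨p', hp', q', hq', e1', e2', e3', e4', -⟩ := hrc y hy h2.1 h2.2
      have e := hκinj q hq q' hq' (by rw [← e4, ← e4', h])
      have hx3 := hne x hx h1.1 h1.2
      have hy3 := hne y hy h2.1 h2.2
      clear hx' hy'
      by_contra hcon
      have := bentRow_increasing (x := -Y y) (y := X y) (x' := -Y x) (y' := X x)
        (by omega) (by omega) (by rw [e2, e2', e]) (by omega)
      omega
    · obtain ⟨p, hp, q, hq, e1, e2, e3, e4, -⟩ := hrc x hx h1.1 h1.2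
      rw [hc y, if_neg h2, e4] at h
      have := hv q hq
      rw [h] at this
      rcases hx' with hx' | hx' | hx' <;> rcases hy' with hy' | hy' | hy' <;> omega
    · obtain ⟨p, hp, q, hq, e1, e2, e3, e4, -⟩ := hrc y hy h2.1 h2.2
      rw [hc x, if_neg h1, e4] at h
      have := hv q hq
      rw [← h] at this
      rcases hx' with hx' | hx' | hx' <;> rcases hy' with hy' | hy' | hy' <;> omega
    · rw [hc x, if_neg h1, hc y, if_neg h2] at h
      rw [h] at hx'
      rcases hx' with hx' | hx' | hx' <;> rcases hy' with hy' | hy' | hy' <;> omega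
  · intro x hx
    have hxm := mem_cells.1 (Finset.mem_of_mem_erase hx)
    by_cases h1 : 0 ≤ v x.2 ∧ 0 ≤ u x.1
    · obtain ⟨p, hp, q, hq, -, -, e3, e4, e5⟩ := hrc x hx h1.1 h1.2
      rw [e3, e4]
      exact hlcell p hp q hq e5
    · rw [hr, hc, if_neg h1, if_neg h1]
      rcases hu' x.1 with h3 | ⟨p, hp, hpx, h3⟩
      · rw [hoff _ h3.2]
        exact hxm.2
      rcases hv' x.2 with h4 | ⟨q, hq, hqx, h4⟩
      · have h5 := h4.2 p hp
        have h6 := heven p hp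
        have h7 := hodd p hp
        rw [hpx] at h6 h7
        omega
      · omega

/-- A finite set of planar points, ordered from left to right, with ties in decreasing order of
height, gives a permutation; a placement on the cells of a Young diagram gives its shape. -/
theorem hasShape_of_coordinates (S : Finset (ℕ × ℕ)) (X Y : ℕ × ℕ → ℤ) (p : YPartition)
    (hcard : size p = S.card) (r c : ℕ × ℕ → ℕ) (π : Equiv.Perm (Fin S.card)) (e : Fin S.card ≃ S)
    (hpos : ∀ i j, i < j ↔ (toLex (X (e i), -Y (e i)) : ℤ ×ₗ ℤ) < toLex (X (e j), -Y (e j)))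
    (hval : ∀ i j, π i < π j ↔ (toLex (Y (e i), X (e i)) : ℤ ×ₗ ℤ) < toLex (Y (e j), X (e j)))
    (hr : ∀ x ∈ S, ∀ y ∈ S, (X x < X y ∨ X x = X y ∧ Y y < Y x) → r x = r y →
      X x < X y ∧ Y x ≤ Y y)
    (hc : ∀ x ∈ S, ∀ y ∈ S, (X x < X y ∨ X x = X y ∧ Y y < Y x) → c x = c y →
      X x ≤ X y ∧ Y y < Y x)
    (hcell : ∀ x ∈ S, c x < p.parts (r x)) : HasShape π p := by
  refine hasShape_of_placement π p hcard (fun i => r (e i)) (fun i => c (e i)) ?_ ?_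
    fun i => hcell _ (e i).2
  · intro i j hij h
    rw [hpos, Prod.Lex.toLex_lt_toLex] at hij
    have := hr _ (e i).2 _ (e j).2 (by simpa using hij) h
    rw [hval, Prod.Lex.toLex_lt_toLex]
    simp only
    omega
  · intro i j hij h
    rw [hpos, Prod.Lex.toLex_lt_toLex] at hij
    have := hc _ (e i).2 _ (e j).2 (by simpa using hij) h
    rw [hval, Prod.Lex.toLex_lt_toLex]
    simp only
    omega

theorem cover_witnessed_by_involvement (lam μ : YPartition)
    (hdom : DoublyDominates μ lam) (hsize : size μ = size lam + 1) :
    ∃ (a b : ℕ) (σ : Equiv.Perm (Fin a)) (π : Equiv.Perm (Fin b)),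
      HasShape σ lam ∧ HasShape π μ ∧ Involved σ π := by
  obtain ⟨N₁, h₁⟩ := lam.finite
  obtain ⟨N₂, h₂⟩ := μ.finite
  obtain ⟨N, hN₁, hN₂, hN⟩ : ∃ N, (∀ i, N ≤ i → lam.parts i = 0) ∧
      (∀ i, N ≤ i → μ.parts i = 0) ∧ ∀ i, μ.parts i ≤ N :=
    ⟨N₁ + N₂ + μ.parts 0, fun i hi => h₁ i (by omega), fun i hi => h₂ i (by omega),
      fun i => (μ.antitone 0 i (by omega)).trans (by omega)⟩
  have hμ := size_eq_psum μ hN₂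
  have hlam := size_eq_psum lam hN₁
  obtain ⟨t, ρ, κ, hκ, hρ, heven, hodd, hoff⟩ := exists_alternating_chain lam.antitone μ.antitone
    hN₁ hN₂ hdom.1 (psum_le_psum_add_one hdom hsize) (by omega)
  have hρN : ρ 0 < N := by
    by_contra h
    have h1 := heven 0 (by omega) rfl
    have h2 := hN₂ (ρ 0) (by omega)
    omega
  obtain ⟨X, Y, r, c, o, ho, hXY, hr, hc, hr', hc', hcell⟩ :=
    exists_coordinates hN hκ hρ heven hodd hoff hρN
  set D := cells μ.parts N with hD
  have hDcard : D.card = size μ := by rw [hD, card_cells, hμ]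
  have hpos : Set.InjOn (fun x => (toLex (X x, -Y x) : ℤ ×ₗ ℤ)) D := by
    intro x hx y hy h
    have h := toLex.injective h
    simp only [Prod.mk.injEq, neg_inj] at h
    exact hXY x hx y hy h.1 h.2
  have hval : Set.InjOn (fun x => (toLex (Y x, X x) : ℤ ×ₗ ℤ)) D := by
    intro x hx y hy h
    have h := toLex.injective h
    simp only [Prod.mk.injEq] at h
    exact hXY x hx y hy h.2 h.1
  have hsub : ((D.erase o : Finset (ℕ × ℕ)) : Set (ℕ × ℕ)) ⊆ D :=
    Finset.coe_subset.2 (Finset.erase_subset _ _)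
  obtain ⟨π, e, he, hπ⟩ := exists_perm_of_keys D _ _ hpos hval
  obtain ⟨σ, f, hf, hσ⟩ := exists_perm_of_keys (D.erase o) _ _ (hpos.mono hsub) (hval.mono hsub)
  refine ⟨_, _, σ, π, ?_, ?_, ?_⟩
  · exact hasShape_of_coordinates _ X Y lam (by rw [Finset.card_erase_of_mem ho]; omega) r c σ f
      hf hσ hr' hc' hcell
  · exact hasShape_of_coordinates _ X Y μ hDcard.symm Prod.fst Prod.snd π e he hπ hr hc
      fun x hx => (mem_cells.1 hx).2
  · refine ⟨fun i => e.symm ⟨f i, hsub (f i).2⟩, fun i j hij => ?_, fun i j => ?_⟩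
    · rw [he]
      simpa using (hf i j).1 hij
    · rw [hσ, hπ]
      simp
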